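/- Let f : ℝ^{m×n} → ℝ be L-smooth with infimum f*, and consider one step W^{t+1} = W^t − γ Ĝ^t, where Ĝ^t = H_B^t G^t with probability p and Ĝ^t = G^t H_A^t with probability 1−p, the random orthogonal projections H_B^t, H_A^t being independent of G^t and of the coin, with λ_min(E[H_B]), λ_min(E[H_A]) > 0. Then E[f(W^{t+1}) − f* | W^t] ≤ f(W^t) − f* − (γ λ_min^p/2) ‖∇f(W^t)‖_F² + (γ λ_max^p/2) ‖G^t − ∇f(W^t)‖_F² − (1/(2γ) − L/2) E[‖W^{t+1} − W^t‖_F² | W^t]. -/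

import Mathlib

open MeasureTheory ProbabilityTheory Finset Matrix
open scoped ENNReal

/-- Frobenius norm of a real matrix. -/
noncomputable def fnorm {m n : ℕ} (W : Matrix (Fin m) (Fin n) ℝ) : ℝ :=
  Real.sqrt (∑ i, ∑ j, (W i j) ^ 2)

/-- Trace (Frobenius) inner product of two real matrices. -/
def fdot {m n : ℕ} (X Y : Matrix (Fin m) (Fin n) ℝ) : ℝ := ∑ i, ∑ j, X i j * Y i j

/-- Pi measurable structure on real matrices. -/
instance matMS {m n : ℕ} : MeasurableSpace (Matrix (Fin m) (Fin n) ℝ) :=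
  inferInstanceAs (MeasurableSpace (Fin m → Fin n → ℝ))

theorem fdot_eq_trace {m n : ℕ} (X Y : Matrix (Fin m) (Fin n) ℝ) :
    fdot X Y = (Xᵀ * Y).trace := by
  simp only [fdot, trace, Matrix.diag, mul_apply, transpose_apply]
  exact sum_comm

theorem fdot_comm {m n : ℕ} (X Y : Matrix (Fin m) (Fin n) ℝ) : fdot X Y = fdot Y X := by
  simp only [fdot, mul_comm]

theorem fdot_sub_left {m n : ℕ} (X Y Z : Matrix (Fin m) (Fin n) ℝ) :
    fdot (X - Y) Z = fdot X Z - fdot Y Z := by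
  simp only [fdot_eq_trace, transpose_sub, Matrix.sub_mul, trace_sub]

theorem fdot_sub_right {m n : ℕ} (X Y Z : Matrix (Fin m) (Fin n) ℝ) :
    fdot X (Y - Z) = fdot X Y - fdot X Z := by
  simp only [fdot_eq_trace, Matrix.mul_sub, trace_sub]

theorem fdot_smul_left {m n : ℕ} (a : ℝ) (X Y : Matrix (Fin m) (Fin n) ℝ) :
    fdot (a • X) Y = a * fdot X Y := by
  simp [fdot_eq_trace]

theorem fdot_smul_right {m n : ℕ} (a : ℝ) (X Y : Matrix (Fin m) (Fin n) ℝ) :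
    fdot X (a • Y) = a * fdot X Y := by
  simp [fdot_eq_trace]

theorem fnorm_nonneg {m n : ℕ} (X : Matrix (Fin m) (Fin n) ℝ) : 0 ≤ fnorm X :=
  Real.sqrt_nonneg _

theorem fnorm_sq {m n : ℕ} (X : Matrix (Fin m) (Fin n) ℝ) :
    fnorm X ^ 2 = ∑ i, ∑ j, X i j ^ 2 :=
  Real.sq_sqrt (sum_nonneg fun _ _ => sum_nonneg fun _ _ => sq_nonneg _)

theorem fnorm_sq_eq_fdot {m n : ℕ} (X : Matrix (Fin m) (Fin n) ℝ) :
    fnorm X ^ 2 = fdot X X := by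
  rw [fnorm_sq]
  simp only [fdot, sq]

theorem fnorm_smul {m n : ℕ} (a : ℝ) (X : Matrix (Fin m) (Fin n) ℝ) :
    fnorm (a • X) = |a| * fnorm X := by
  rw [← sq_eq_sq₀ (fnorm_nonneg _) (mul_nonneg (abs_nonneg _) (fnorm_nonneg _)), mul_pow, sq_abs,
    fnorm_sq_eq_fdot, fnorm_sq_eq_fdot, fdot_smul_left, fdot_smul_right]
  ring

/-- Cauchy–Schwarz for the trace inner product. -/
theorem fdot_le_fnorm_mul_fnorm {m n : ℕ} (X Y : Matrix (Fin m) (Fin n) ℝ) :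
    fdot X Y ≤ fnorm X * fnorm Y := by
  simp only [fdot, fnorm, ← Fintype.sum_prod_type']
  exact Real.sum_mul_le_sqrt_mul_sqrt univ (fun x : Fin m × Fin n => X x.1 x.2)
    (fun x => Y x.1 x.2)

/-- The quadratic upper bound for functions with Lipschitz gradient. -/
theorem le_add_fdot_add_sq_of_lipschitz_gradient {m n : ℕ}
    {f : Matrix (Fin m) (Fin n) ℝ → ℝ}
    {gradf : Matrix (Fin m) (Fin n) ℝ → Matrix (Fin m) (Fin n) ℝ} {L : ℝ}
    (hderiv : ∀ W X, HasDerivAt (fun s : ℝ => f (W + s • X)) (fdot (gradf W) X) 0)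
    (hsmooth : ∀ W V, fnorm (gradf W - gradf V) ≤ L * fnorm (W - V))
    (W D : Matrix (Fin m) (Fin n) ℝ) :
    f (W + D) ≤ f W + fdot (gradf W) D + L / 2 * fnorm D ^ 2 := by
  have hline : ∀ s : ℝ, HasDerivAt (fun s : ℝ => f (W + s • D)) (fdot (gradf (W + s • D)) D) s := by
    intro s
    have h := hderiv (W + s • D) D
    rw [← sub_self s] at h
    have h' := h.comp_sub_const s s
    refine h'.congr_of_eventuallyEq (Filter.Eventually.of_forall fun t => ?_)
    simp only [add_assoc, ← add_smul, add_sub_cancel]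
  have hgap : ∀ s : ℝ, HasDerivAt
      (fun s : ℝ => f (W + s • D) - s * fdot (gradf W) D - L / 2 * fnorm D ^ 2 * s ^ 2)
      (fdot (gradf (W + s • D)) D - fdot (gradf W) D - L * fnorm D ^ 2 * s) s := by
    intro s
    refine (((hline s).sub ((hasDerivAt_id s).mul_const _)).sub
      ((hasDerivAt_pow 2 s).const_mul (L / 2 * fnorm D ^ 2))).congr_deriv ?_
    norm_num
    ring
  have hanti := antitoneOn_of_deriv_nonpos (convex_Icc (0 : ℝ) 1)
    (fun s _ => (hgap s).continuousAt.continuousWithinAt)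
    (fun s _ => (hgap s).differentiableAt.differentiableWithinAt) (fun s hs => by
      rw [interior_Icc] at hs
      rw [(hgap s).deriv, ← fdot_sub_left]
      have hle := hsmooth (W + s • D) W
      rw [add_sub_cancel_left, fnorm_smul, abs_of_pos hs.1] at hle
      have := mul_le_mul_of_nonneg_right hle (fnorm_nonneg D)
      linarith [fdot_le_fnorm_mul_fnorm (gradf (W + s • D) - gradf W) D])
  have h := hanti (Set.left_mem_Icc.2 zero_le_one) (Set.right_mem_Icc.2 zero_le_one) zero_le_one
  norm_num at h
  linarith

/-- Quadratic form of a left multiplication, column by column. -/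
theorem fdot_mul_left_eq_sum {m n : ℕ} (X : Matrix (Fin m) (Fin n) ℝ)
    (H : Matrix (Fin m) (Fin m) ℝ) :
    fdot X (H * X) = ∑ j, (fun i => X i j) ⬝ᵥ H *ᵥ (fun i => X i j) := by
  simp only [fdot, dotProduct, mulVec, mul_apply]
  exact sum_comm

/-- Quadratic form of a right multiplication, row by row. -/
theorem fdot_mul_right_eq_sum {m n : ℕ} (X : Matrix (Fin m) (Fin n) ℝ)
    (K : Matrix (Fin n) (Fin n) ℝ) :
    fdot X (X * K) = ∑ i, X i ⬝ᵥ K *ᵥ X i := by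
  simp only [dotProduct_mulVec]
  simp only [fdot, dotProduct, vecMul, mul_apply]
  simp only [mul_comm]

theorem fdot_projection_step {m n : ℕ}
    {P : Matrix (Fin m) (Fin n) ℝ → Matrix (Fin m) (Fin n) ℝ}
    (hsub : ∀ X Y, P (X - Y) = P X - P Y)
    (hsymm : ∀ X Y, fdot X (P Y) = fdot (P X) Y) (hidem : ∀ X, P (P X) = P X)
    (G V : Matrix (Fin m) (Fin n) ℝ) :
    2 * fdot V (P G) = fdot V (P V) + fnorm (P G) ^ 2 - fdot (G - V) (P (G - V)) := by
  have hG : fnorm (P G) ^ 2 = fdot G (P G) := by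
    rw [fnorm_sq_eq_fdot, ← hsymm, hidem]
  have hGV : fdot G (P V) = fdot V (P G) := by rw [hsymm, fdot_comm]
  rw [hG, hsub, fdot_sub_left, fdot_sub_right, fdot_sub_right, hGV]
  ring

theorem abs_apply_le_one_of_isProjection {k : ℕ} {H : Matrix (Fin k) (Fin k) ℝ}
    (hH : Hᵀ = H ∧ H * H = H) (i j : Fin k) : |H i j| ≤ 1 := by
  have hdiag : ∑ l, H i l ^ 2 = H i i := by
    conv_rhs => rw [← hH.2, mul_apply]
    refine sum_congr rfl fun l _ => ?_
    rw [sq, ← congrFun (congrFun hH.1 l) i, transpose_apply]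
  have hle : ∀ l, H i l ^ 2 ≤ H i i := fun l =>
    hdiag ▸ single_le_sum (f := fun l => H i l ^ 2) (fun _ _ => sq_nonneg _) (mem_univ l)
  rw [← sq_le_one_iff_abs_le_one]
  nlinarith [hle i, hle j]

theorem measurable_matrix_apply {m n : ℕ} (i : Fin m) (j : Fin n) :
    Measurable fun X : Matrix (Fin m) (Fin n) ℝ => X i j :=
  (measurable_pi_apply j).comp (measurable_pi_apply (X := fun _ : Fin m => Fin n → ℝ) i)

theorem measurable_fdot_mul_left {m n : ℕ} (X : Matrix (Fin m) (Fin n) ℝ) :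
    Measurable fun H : Matrix (Fin m) (Fin m) ℝ => fdot X (H * X) := by
  have := fun i j => measurable_matrix_apply (m := m) (n := m) i j
  simp only [fdot, mul_apply]
  fun_prop

theorem measurable_fdot_mul_right {m n : ℕ} (X : Matrix (Fin m) (Fin n) ℝ) :
    Measurable fun K : Matrix (Fin n) (Fin n) ℝ => fdot X (X * K) := by
  have := fun i j => measurable_matrix_apply (m := n) (n := n) i j
  simp only [fdot, mul_apply]
  fun_prop

section RandomProjection

variable {Ω : Type*} [MeasurableSpace Ω] {μ : Measure Ω}

theorem integrable_apply_of_isProjection [IsFiniteMeasure μ] {k : ℕ}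
    {H : Ω → Matrix (Fin k) (Fin k) ℝ} (hmeas : Measurable H)
    (hH : ∀ ω, (H ω)ᵀ = H ω ∧ H ω * H ω = H ω) (i j : Fin k) :
    Integrable (fun ω => H ω i j) μ :=
  Integrable.of_bound ((measurable_matrix_apply i j).comp hmeas).aestronglyMeasurable 1
    (Filter.Eventually.of_forall fun ω => abs_apply_le_one_of_isProjection (hH ω) i j)

theorem integrable_fdot_mul_left {m n : ℕ} {H : Ω → Matrix (Fin m) (Fin m) ℝ}
    (hH : ∀ i j, Integrable (fun ω => H ω i j) μ) (X : Matrix (Fin m) (Fin n) ℝ) :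
    Integrable (fun ω => fdot X (H ω * X)) μ := by
  simp only [fdot, mul_apply]
  exact integrable_finsetSum _ fun i _ => integrable_finsetSum _ fun j _ =>
    (integrable_finsetSum _ fun k _ => (hH i k).mul_const _).const_mul _

theorem integrable_fdot_mul_right {m n : ℕ} {K : Ω → Matrix (Fin n) (Fin n) ℝ}
    (hK : ∀ i j, Integrable (fun ω => K ω i j) μ) (X : Matrix (Fin m) (Fin n) ℝ) :
    Integrable (fun ω => fdot X (X * K ω)) μ := by
  simp only [fdot, mul_apply]
  exact integrable_finsetSum _ fun i _ => integrable_finsetSum _ fun j _ =>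
    (integrable_finsetSum _ fun k _ => (hK k j).const_mul _).const_mul _

theorem integral_fdot_mul_left {m n : ℕ} {H : Ω → Matrix (Fin m) (Fin m) ℝ}
    {EH : Matrix (Fin m) (Fin m) ℝ} (hH : ∀ i j, Integrable (fun ω => H ω i j) μ)
    (hEH : ∀ i j, ∫ ω, H ω i j ∂μ = EH i j) (X : Matrix (Fin m) (Fin n) ℝ) :
    ∫ ω, fdot X (H ω * X) ∂μ = fdot X (EH * X) := by
  have hterm : ∀ i j, Integrable (fun ω => X i j * ∑ k, H ω i k * X k j) μ := fun i j =>
    (integrable_finsetSum _ fun k _ => (hH i k).mul_const _).const_mul _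
  simp only [fdot, mul_apply]
  rw [integral_finsetSum]
  swap
  · exact fun i _ => integrable_finsetSum _ fun j _ => hterm i j
  refine sum_congr rfl fun i _ => ?_
  rw [integral_finsetSum _ fun j _ => hterm i j]
  refine sum_congr rfl fun j _ => ?_
  rw [integral_const_mul, integral_finsetSum]
  swap
  · exact fun k _ => (hH i k).mul_const _
  simp only [integral_mul_const, hEH]

theorem integral_fdot_mul_right {m n : ℕ} {K : Ω → Matrix (Fin n) (Fin n) ℝ}
    {EK : Matrix (Fin n) (Fin n) ℝ} (hK : ∀ i j, Integrable (fun ω => K ω i j) μ)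
    (hEK : ∀ i j, ∫ ω, K ω i j ∂μ = EK i j) (X : Matrix (Fin m) (Fin n) ℝ) :
    ∫ ω, fdot X (X * K ω) ∂μ = fdot X (X * EK) := by
  have hterm : ∀ i j, Integrable (fun ω => X i j * ∑ k, X i k * K ω k j) μ := fun i j =>
    (integrable_finsetSum _ fun k _ => (hK k j).const_mul _).const_mul _
  simp only [fdot, mul_apply]
  rw [integral_finsetSum]
  swap
  · exact fun i _ => integrable_finsetSum _ fun j _ => hterm i j
  refine sum_congr rfl fun i _ => ?_
  rw [integral_finsetSum _ fun j _ => hterm i j]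
  refine sum_congr rfl fun j _ => ?_
  rw [integral_const_mul, integral_finsetSum]
  swap
  · exact fun k _ => (hK k j).const_mul _
  simp only [integral_const_mul, hEK]

/-- Expectation of a choice between two random variables by an independent Bernoulli coin. -/
theorem integral_ite_coin [IsProbabilityMeasure μ] {E : Type*} [MeasurableSpace E]
    {p : ℝ} (hp : 0 ≤ p) {c : Ω → Bool} {Z : Ω → E} (hc : Measurable c) (hZ : Measurable Z)
    (hcoin : μ {ω | c ω = true} = ENNReal.ofReal p) (hindep : IndepFun c Z μ)
    {φ ψ : E → ℝ} (hφ : Measurable φ) (hψ : Measurable ψ)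
    (hφi : Integrable (fun ω => φ (Z ω)) μ) (hψi : Integrable (fun ω => ψ (Z ω)) μ) :
    ∫ ω, (if c ω then φ (Z ω) else ψ (Z ω)) ∂μ =
      p * ∫ ω, φ (Z ω) ∂μ + (1 - p) * ∫ ω, ψ (Z ω) ∂μ := by
  have hset : MeasurableSet {ω | c ω = true} := hc (measurableSet_singleton true)
  have hone : ∫ ω, (if c ω then (1 : ℝ) else 0) ∂μ = p := by
    have : (fun ω => if c ω then (1 : ℝ) else 0) = {ω | c ω = true}.indicator 1 := by
      ext ω; simp [Set.indicator_apply]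
    rw [this, integral_indicator_one hset, measureReal_def, hcoin, ENNReal.toReal_ofReal hp]
  have hmul : ∀ g : E → ℝ, Measurable g →
      ∫ ω, (if c ω then (1 : ℝ) else 0) * g (Z ω) ∂μ = p * ∫ ω, g (Z ω) ∂μ := fun g hg => by
    rw [← hone]
    exact hindep.integral_fun_comp_mul_comp (f := fun b : Bool => if b then (1 : ℝ) else 0)
      hc.aemeasurable hZ.aemeasurable (measurable_of_countable _).aestronglyMeasurable
      hg.aestronglyMeasurable
  have hint : ∀ g : E → ℝ, Integrable (fun ω => g (Z ω)) μ →
      Integrable (fun ω => (if c ω then (1 : ℝ) else 0) * g (Z ω)) μ := fun g hg => by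
    refine (hg.indicator hset).congr (Filter.Eventually.of_forall fun ω => ?_)
    simp [Set.indicator_apply]
  have hadd : Integrable (fun ω => (if c ω then (1 : ℝ) else 0) * φ (Z ω) + ψ (Z ω)) μ :=
    (hint φ hφi).add hψi
  calc ∫ ω, (if c ω then φ (Z ω) else ψ (Z ω)) ∂μ
      = ∫ ω, ((if c ω then (1 : ℝ) else 0) * φ (Z ω) + ψ (Z ω)
          - (if c ω then (1 : ℝ) else 0) * ψ (Z ω)) ∂μ := by
        congr with ω
        cases c ω <;> simp
    _ = _ := by
        rw [integral_sub hadd (hint ψ hψi), integral_add (hint φ hφi) hψi,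
          hmul φ hφ, hmul ψ hψ]
        ring

end RandomProjection

/-- **One-step descent lemma for Bernoulli-LoRA updates** (conditionally on `W^t, G^t`). -/
theorem bernoulli_lora_descent_lemma
    {m n : ℕ}
    (f : Matrix (Fin m) (Fin n) ℝ → ℝ)
    (gradf : Matrix (Fin m) (Fin n) ℝ → Matrix (Fin m) (Fin n) ℝ)
    (L fstar : ℝ) (hL : 0 < L)
    -- gradf is the gradient of f (w.r.t. the trace inner product)
    (hderiv : ∀ W X, HasDerivAt (fun s : ℝ => f (W + s • X)) (fdot (gradf W) X) 0)
    -- L-smoothness of f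
    (hsmooth : ∀ W V, fnorm (gradf W - gradf V) ≤ L * fnorm (W - V))
    -- f is bounded below by fstar
    (hlb : ∀ W, fstar ≤ f W)
    -- probability space and one step of randomness
    {Ω : Type*} [MeasurableSpace Ω] (μ : Measure Ω) [IsProbabilityMeasure μ]
    (p : ℝ) (hp0 : 0 ≤ p) (hp1 : p ≤ 1)
    (c : Ω → Bool)
    (HBs : Ω → Matrix (Fin m) (Fin m) ℝ) (HAs : Ω → Matrix (Fin n) (Fin n) ℝ)
    (hmeas : Measurable (fun ω => (c ω, HBs ω, HAs ω)))
    -- the sketches are orthogonal projection matrices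
    (hHBproj : ∀ ω, (HBs ω)ᵀ = HBs ω ∧ HBs ω * HBs ω = HBs ω)
    (hHAproj : ∀ ω, (HAs ω)ᵀ = HAs ω ∧ HAs ω * HAs ω = HAs ω)
    (hcoin : μ {ω | c ω = true} = ENNReal.ofReal p)
    -- the coin is independent of the projections
    (hcoin_indep : IndepFun c (fun ω => (HBs ω, HAs ω)) μ)
    (EHB : Matrix (Fin m) (Fin m) ℝ) (EHA : Matrix (Fin n) (Fin n) ℝ)
    (hEHB : ∀ i j, ∫ ω, HBs ω i j ∂μ = EHB i j)
    (hEHA : ∀ i j, ∫ ω, HAs ω i j ∂μ = EHA i j)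
    (lamB lamA : ℝ) (hlamB0 : 0 < lamB) (hlamA0 : 0 < lamA)
    (hlamB : ∀ v : Fin m → ℝ, lamB * (∑ i, v i ^ 2) ≤ v ⬝ᵥ EHB.mulVec v)
    (hlamA : ∀ v : Fin n → ℝ, lamA * (∑ i, v i ^ 2) ≤ v ⬝ᵥ EHA.mulVec v)
    (lamMinP : ℝ) (hlamMinP : lamMinP = p * lamB + (1 - p) * lamA)
    (lamBmax lamAmax : ℝ)
    (hlamBmax : ∀ v : Fin m → ℝ, v ⬝ᵥ EHB.mulVec v ≤ lamBmax * (∑ i, v i ^ 2))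
    (hlamAmax : ∀ v : Fin n → ℝ, v ⬝ᵥ EHA.mulVec v ≤ lamAmax * (∑ i, v i ^ 2))
    (lamMaxP : ℝ) (hlamMaxP : lamMaxP = p * lamBmax + (1 - p) * lamAmax)
    -- one step of the method from the (conditionally fixed) pair (W^t, G^t)
    (γ : ℝ) (hγ0 : 0 < γ)
    (Wt Gt : Matrix (Fin m) (Fin n) ℝ) (Wnext : Ω → Matrix (Fin m) (Fin n) ℝ)
    (hWnext : ∀ ω, Wnext ω = Wt - γ • (if c ω then HBs ω * Gt else Gt * HAs ω))
    -- integrability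
    (hintf : Integrable (fun ω => f (Wnext ω)) μ)
    (hintW : Integrable (fun ω => (fnorm (Wnext ω - Wt)) ^ 2) μ) :
    ∫ ω, (f (Wnext ω) - fstar) ∂μ ≤
      f Wt - fstar - (γ * lamMinP / 2) * (fnorm (gradf Wt)) ^ 2
        + (γ * lamMaxP / 2) * (fnorm (Gt - gradf Wt)) ^ 2
        - (1 / (2 * γ) - L / 2) * ∫ ω, (fnorm (Wnext ω - Wt)) ^ 2 ∂μ := by
  have hc : Measurable c := hmeas.fst
  have hZ : Measurable fun ω => (HBs ω, HAs ω) := hmeas.snd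
  have hB := integrable_apply_of_isProjection (μ := μ) hZ.fst hHBproj
  have hA := integrable_apply_of_isProjection (μ := μ) hZ.snd hHAproj
  set P : Ω → Matrix (Fin m) (Fin n) ℝ → Matrix (Fin m) (Fin n) ℝ :=
    fun ω X => if c ω then HBs ω * X else X * HAs ω with hP
  have hsub : ∀ ω X Y, P ω (X - Y) = P ω X - P ω Y := by
    intro ω X Y
    simp only [hP]
    split_ifs
    · exact Matrix.mul_sub _ _ _
    · exact Matrix.sub_mul _ _ _
  have hsymm : ∀ ω X Y, fdot X (P ω Y) = fdot (P ω X) Y := by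
    intro ω X Y
    simp only [hP, fdot_eq_trace]
    split_ifs
    · rw [transpose_mul, (hHBproj ω).1, Matrix.mul_assoc]
    · rw [transpose_mul, (hHAproj ω).1, ← Matrix.mul_assoc, trace_mul_comm, ← Matrix.mul_assoc]
  have hidem : ∀ ω X, P ω (P ω X) = P ω X := by
    intro ω X
    simp only [hP]
    split_ifs
    · rw [← Matrix.mul_assoc, (hHBproj ω).2]
    · rw [Matrix.mul_assoc, (hHAproj ω).2]
  have hquad_eq : ∀ X ω, fdot X (P ω X) =
      if c ω then fdot X (HBs ω * X) else fdot X (X * HAs ω) := by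
    intro X ω
    simp only [hP]
    split_ifs <;> rfl
  have hquad_int : ∀ X, Integrable (fun ω => fdot X (P ω X)) μ := by
    intro X
    simp only [hquad_eq]
    exact Integrable.piecewise (s := {ω | c ω = true}) (hc (measurableSet_singleton true))
      (integrable_fdot_mul_left hB X).integrableOn (integrable_fdot_mul_right hA X).integrableOn
  have hquad : ∀ X, ∫ ω, fdot X (P ω X) ∂μ =
      p * fdot X (EHB * X) + (1 - p) * fdot X (X * EHA) := by
    intro X
    simp only [hquad_eq]
    rw [← integral_fdot_mul_left hB hEHB, ← integral_fdot_mul_right hA hEHA]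
    exact integral_ite_coin hp0 hc hZ hcoin hcoin_indep
      ((measurable_fdot_mul_left X).comp measurable_fst)
      ((measurable_fdot_mul_right X).comp measurable_snd)
      (integrable_fdot_mul_left hB X) (integrable_fdot_mul_right hA X)
  have hlow : ∀ X, lamMinP * fnorm X ^ 2 ≤ ∫ ω, fdot X (P ω X) ∂μ := by
    intro X
    have h1 : lamB * fnorm X ^ 2 ≤ fdot X (EHB * X) := by
      rw [fdot_mul_left_eq_sum, fnorm_sq, sum_comm, mul_sum]
      exact sum_le_sum fun j _ => hlamB _
    have h2 : lamA * fnorm X ^ 2 ≤ fdot X (X * EHA) := by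
      rw [fdot_mul_right_eq_sum, fnorm_sq, mul_sum]
      exact sum_le_sum fun i _ => hlamA _
    rw [hquad, hlamMinP]
    linarith [mul_le_mul_of_nonneg_left h1 hp0, mul_le_mul_of_nonneg_left h2 (sub_nonneg.2 hp1)]
  have hupp : ∀ X, ∫ ω, fdot X (P ω X) ∂μ ≤ lamMaxP * fnorm X ^ 2 := by
    intro X
    have h1 : fdot X (EHB * X) ≤ lamBmax * fnorm X ^ 2 := by
      rw [fdot_mul_left_eq_sum, fnorm_sq, sum_comm, mul_sum]
      exact sum_le_sum fun j _ => hlamBmax _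
    have h2 : fdot X (X * EHA) ≤ lamAmax * fnorm X ^ 2 := by
      rw [fdot_mul_right_eq_sum, fnorm_sq, mul_sum]
      exact sum_le_sum fun i _ => hlamAmax _
    rw [hquad, hlamMaxP]
    linarith [mul_le_mul_of_nonneg_left h1 hp0, mul_le_mul_of_nonneg_left h2 (sub_nonneg.2 hp1)]
  have hpath : ∀ ω, f (Wnext ω) - fstar ≤ f Wt - fstar
      - γ / 2 * fdot (gradf Wt) (P ω (gradf Wt))
      + γ / 2 * fdot (Gt - gradf Wt) (P ω (Gt - gradf Wt))
      - (1 / (2 * γ) - L / 2) * fnorm (Wnext ω - Wt) ^ 2 := by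
    intro ω
    have hstep : Wnext ω - Wt = (-γ) • P ω Gt := by
      rw [hWnext, neg_smul, sub_sub_cancel_left]
    have hdesc := le_add_fdot_add_sq_of_lipschitz_gradient hderiv hsmooth Wt (Wnext ω - Wt)
    have hproj := fdot_projection_step (hsub ω) (hsymm ω) (hidem ω) Gt (gradf Wt)
    have hinner : fdot (gradf Wt) (Wnext ω - Wt) = -γ * fdot (gradf Wt) (P ω Gt) := by
      rw [hstep, fdot_smul_right]
    have hnorm : 1 / (2 * γ) * fnorm (Wnext ω - Wt) ^ 2 = γ / 2 * fnorm (P ω Gt) ^ 2 := by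
      rw [hstep, fnorm_smul, mul_pow, sq_abs]
      field_simp
    rw [add_sub_cancel, hinner] at hdesc
    linear_combination hdesc - γ / 2 * hproj + hnorm
  have hi₁ := (hquad_int (gradf Wt)).const_mul (γ / 2)
  have hi₂ := (hquad_int (Gt - gradf Wt)).const_mul (γ / 2)
  have hi₃ := hintW.const_mul (1 / (2 * γ) - L / 2)
  have hi₀ : Integrable (fun _ : Ω => f Wt - fstar) μ := integrable_const _
  have hi₀₁ : Integrable (fun ω => f Wt - fstar
      - γ / 2 * fdot (gradf Wt) (P ω (gradf Wt))) μ := hi₀.sub hi₁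
  have hi₀₁₂ : Integrable (fun ω => f Wt - fstar - γ / 2 * fdot (gradf Wt) (P ω (gradf Wt))
      + γ / 2 * fdot (Gt - gradf Wt) (P ω (Gt - gradf Wt))) μ := hi₀₁.add hi₂
  have hmono := integral_mono (hintf.sub (integrable_const fstar)) (hi₀₁₂.sub hi₃) hpath
  simp only [Pi.sub_apply] at hmono
  rw [integral_sub hi₀₁₂ hi₃, integral_add hi₀₁ hi₂, integral_sub hi₀ hi₁, integral_const_mul,
    integral_const_mul, integral_const_mul] at hmono
  simp only [integral_const, probReal_univ, one_smul] at hmono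
  have hγ : 0 ≤ γ / 2 := by positivity
  linarith [mul_le_mul_of_nonneg_left (hlow (gradf Wt)) hγ,
    mul_le_mul_of_nonneg_left (hupp (Gt - gradf Wt)) hγ]
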